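/- Let W_{1,n−1} be the wheel graph on n ≥ 7 vertices and let k be an even integer with 4 ≤ k < n − 1. Then: (a) if 2n ≥ 5k + 2, then msad_k(W_{1,n−1}) = (k + 2)/2; (b) if 3k + 2 ≤ 2n < 5k + 2, then msad_k(W_{1,n−1}) = n − k; (c) if 2n < 3k + 2, then W_{1,n−1} contains no k-multiset antiresolving set. -/

import Mathlib

open Finset

/-- The multiset representation of `v` with respect to `S`:
the multiset of distances from `v` to the vertices of `S`, counted with multiplicity. -/
noncomputable def mrep {V : Type*} (G : SimpleGraph V) (S : Finset V) (v : V) : Multiset ℕ :=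
  S.val.map (fun s => G.dist v s)

open scoped Classical in
/-- The set of vertices outside `S` having the same multiset representation as `u`. -/
noncomputable def mclass {V : Type*} [Fintype V] (G : SimpleGraph V) (S : Finset V)
    (u : V) : Finset V :=
  Finset.univ.filter (fun v => v ∉ S ∧ mrep G S v = mrep G S u)

open scoped Classical in
/-- `S` is a `k`-multiset antiresolving set (`k`-MARS) of `G`: `S` is nonempty, its complement
is nonempty, and `k` is the largest integer such that every vertex `u ∉ S` has at least `k`
vertices outside `S` (including itself) with its same multiset representation. -/
def IsMARS {V : Type*} [Fintype V] (G : SimpleGraph V) (S : Finset V) (k : ℕ) : Prop :=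
  S.Nonempty ∧ Sᶜ.Nonempty ∧
    (∀ u ∉ S, k ≤ (mclass G S u).card) ∧ (∃ u ∉ S, (mclass G S u).card = k)

/-- The wheel graph `W_{1,m}` on `m + 1` vertices: the hub `none` is adjacent to every rim
vertex `some i`, and rim vertices `some i`, `some j` are adjacent iff `j ≡ i ± 1 (mod m)`. -/
def wheel (m : ℕ) : SimpleGraph (Option (Fin m)) :=
  SimpleGraph.fromRel (fun u v =>
    u = none ∨ ∃ i j : Fin m, u = some i ∧ v = some j ∧ (j : ℕ) = ((i : ℕ) + 1) % m)

/-- `msad_k(G) = m`: `G` has a `k`-multiset antiresolving set of cardinality `m`, and every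
`k`-multiset antiresolving set of `G` has cardinality at least `m`. -/
def MsadEq {V : Type*} [Fintype V] (G : SimpleGraph V) (k m : ℕ) : Prop :=
  (∃ S : Finset V, IsMARS G S k ∧ S.card = m) ∧
    ∀ S : Finset V, IsMARS G S k → m ≤ S.card

/-- The number of rim neighbours of the rim vertex `i` lying in `T`. -/
def rimDegree {m : ℕ} [NeZero m] (T : Finset (Fin m)) (i : Fin m) : ℕ :=
  (if i + 1 ∈ T then 1 else 0) + (if i - 1 ∈ T then 1 else 0)

/-- The rim vertices outside `T` with exactly `a` rim neighbours in `T`. -/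
def rimClass {m : ℕ} [NeZero m] (T : Finset (Fin m)) (a : ℕ) : Finset (Fin m) :=
  Finset.univ.filter (fun i => i ∉ T ∧ rimDegree T i = a)

lemma mem_rimClass {m : ℕ} [NeZero m] {T : Finset (Fin m)} {a : ℕ} {i : Fin m} :
    i ∈ rimClass T a ↔ i ∉ T ∧ rimDegree T i = a := by
  simp [rimClass]

lemma mem_mclass {V : Type*} [Fintype V] {G : SimpleGraph V} {S : Finset V} {u v : V} :
    v ∈ mclass G S u ↔ v ∉ S ∧ mrep G S v = mrep G S u := by
  simp [mclass]

section DiameterTwo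

variable {V : Type*} {G : SimpleGraph V} {S : Finset V}

open scoped Classical in
/-- In a connected graph of diameter at most two, the representation of a vertex outside `S`
is determined by its number of neighbours in `S`. -/
lemma mrep_eq_replicate (hG : G.Connected) (h2 : ∀ u v, G.dist u v ≤ 2) {v : V} (hv : v ∉ S) :
    mrep G S v = Multiset.replicate (S.filter (G.Adj v)).card 1 +
      Multiset.replicate (S.filter (fun s => ¬ G.Adj v s)).card 2 := by
  have hone : (S.filter (G.Adj v)).val.map (fun s => G.dist v s) =
      Multiset.replicate (S.filter (G.Adj v)).card 1 := by
    rw [Multiset.eq_replicate]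
    refine ⟨by rw [Multiset.card_map, Finset.card_val], fun b hb => ?_⟩
    obtain ⟨s, hs, rfl⟩ := Multiset.mem_map.1 hb
    exact SimpleGraph.dist_eq_one_iff_adj.2 (Finset.mem_filter.1 hs).2
  have htwo : (S.filter (fun s => ¬ G.Adj v s)).val.map (fun s => G.dist v s) =
      Multiset.replicate (S.filter (fun s => ¬ G.Adj v s)).card 2 := by
    rw [Multiset.eq_replicate]
    refine ⟨by rw [Multiset.card_map, Finset.card_val], fun b hb => ?_⟩
    obtain ⟨s, hs, rfl⟩ := Multiset.mem_map.1 hb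
    obtain ⟨hsS, hadj⟩ := Finset.mem_filter.1 hs
    have hpos := hG.pos_dist_of_ne (u := v) (v := s) (fun h => hv (h ▸ hsS))
    have hne : G.dist v s ≠ 1 := fun h => hadj (SimpleGraph.dist_eq_one_iff_adj.1 h)
    have := h2 v s
    omega
  rw [← hone, ← htwo, ← Multiset.map_add]
  simp only [Finset.filter_val, Multiset.filter_add_not, mrep]

open scoped Classical in
lemma mrep_eq_iff (hG : G.Connected) (h2 : ∀ u v, G.dist u v ≤ 2) {u v : V}
    (hu : u ∉ S) (hv : v ∉ S) :
    mrep G S u = mrep G S v ↔ (S.filter (G.Adj u)).card = (S.filter (G.Adj v)).card := by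
  rw [mrep_eq_replicate hG h2 hu, mrep_eq_replicate hG h2 hv]
  have hcu := S.card_filter_add_card_filter_not (G.Adj u)
  have hcv := S.card_filter_add_card_filter_not (G.Adj v)
  constructor
  · intro h
    have := congrArg (Multiset.count 1) h
    simpa [Multiset.count_replicate] using this
  · intro h
    have h' : (S.filter (fun s => ¬ G.Adj u s)).card =
        (S.filter (fun s => ¬ G.Adj v s)).card := by omega
    rw [h, h']

end DiameterTwo

lemma card_range_filter_mod_three_ne {c : ℕ} (hc : c < 3) (h : ℕ) :
    ((Finset.range (3 * h)).filter (fun i => i % 3 ≠ c)).card = 2 * h := by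
  induction h with
  | zero => simp
  | succ h ih =>
    rw [Nat.mul_succ, Finset.range_add_one, Finset.filter_insert, Finset.range_add_one,
      Finset.filter_insert, Finset.range_add_one, Finset.filter_insert]
    interval_cases c <;> simp [Nat.add_mod, ih] <;> omega

lemma card_filter_lt_mod_three_ne {m c h : ℕ} (hc : c < 3) (hh : 3 * h ≤ m) :
    (Finset.univ.filter (fun i : Fin m => (i : ℕ) < 3 * h ∧ (i : ℕ) % 3 ≠ c)).card = 2 * h := by
  rw [← card_range_filter_mod_three_ne hc h, ← Finset.card_map Fin.valEmbedding]
  congr 1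
  ext x
  simp only [mem_map, mem_filter, mem_univ, true_and, Fin.valEmbedding_apply, mem_range]
  exact ⟨by rintro ⟨i, hi, rfl⟩; exact hi, fun hx => ⟨⟨x, by omega⟩, hx, rfl⟩⟩

section Wheel

variable {m : ℕ} [NeZero m]

lemma wheel_adj_none_some (i : Fin m) : (wheel m).Adj none (some i) := by
  simp [wheel]

lemma wheel_connected : (wheel m).Connected := by
  have : Nonempty (Option (Fin m)) := ⟨none⟩
  have h (u : Option (Fin m)) : (wheel m).Reachable none u := by
    cases u with
    | none => rfl
    | some i => exact (wheel_adj_none_some i).reachable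
  exact ⟨fun u v => (h u).symm.trans (h v)⟩

lemma wheel_dist_le_two (u v : Option (Fin m)) : (wheel m).dist u v ≤ 2 := by
  have h (w : Option (Fin m)) : (wheel m).dist none w ≤ 1 := by
    cases w with
    | none => simp
    | some i => exact (SimpleGraph.dist_eq_one_iff_adj.2 (wheel_adj_none_some i)).le
  have htri := wheel_connected.dist_triangle (u := u) (v := none) (w := v)
  have hu := h u
  have hv := h v
  rw [SimpleGraph.dist_comm] at hu
  omega

lemma wheel_adj_some_some (hm : 3 ≤ m) (i j : Fin m) :
    (wheel m).Adj (some i) (some j) ↔ j = i + 1 ∨ j = i - 1 := by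
  have key (a b : Fin m) : (b : ℕ) = ((a : ℕ) + 1) % m ↔ b = a + 1 := by
    rw [Fin.ext_iff, Fin.val_add, Fin.val_one', Nat.add_mod_mod]
  have hone : (1 : Fin m) ≠ 0 := by
    rw [Ne, Fin.ext_iff, Fin.val_one', Fin.val_zero, Nat.mod_eq_of_lt (by omega)]
    omega
  simp only [wheel, SimpleGraph.fromRel_adj, key, Option.some.injEq, reduceCtorEq, false_or,
    ne_eq, existsAndEq, and_true, exists_eq_left', eq_sub_iff_add_eq]
  constructor
  · rintro ⟨-, h⟩
    exact h.imp id Eq.symm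
  · intro h
    refine ⟨?_, h.imp id Eq.symm⟩
    rintro rfl
    rcases h with h | h <;> simp [hone] at h

open scoped Classical in
/-- When the hub belongs to `S`, it contributes one neighbour to every rim vertex. -/
lemma card_filter_adj_some (hm : 3 ≤ m) (T : Finset (Fin m)) (i : Fin m) :
    ((insertNone T).filter ((wheel m).Adj (some i))).card = rimDegree T i + 1 := by
  have hset : (insertNone T).filter ((wheel m).Adj (some i)) =
      insertNone (T.filter (fun j => j = i + 1 ∨ j = i - 1)) := by
    ext (_ | j)
    · simp [(wheel_adj_none_some i).symm]
    · simp [wheel_adj_some_some hm]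
  have hdisj : Disjoint (T.filter (· = i + 1)) (T.filter (· = i - 1)) := by
    rw [Finset.disjoint_filter]
    rintro j - rfl h
    have h2 : (1 : Fin m) + 1 = 0 := by
      have := congrArg (fun x => x - i + 1) h
      simpa [sub_eq_add_neg, add_assoc, add_comm, add_left_comm] using this
    rw [Fin.ext_iff, Fin.val_add, Fin.val_one', Fin.val_zero, Nat.mod_eq_of_lt (by omega : 1 < m),
      Nat.mod_eq_of_lt (by omega)] at h2
    omega
  rw [hset, card_insertNone, Finset.filter_or, Finset.card_union_of_disjoint hdisj,
    Finset.filter_eq', Finset.filter_eq', rimDegree]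
  split_ifs <;> simp

lemma card_mclass_insertNone (hm : 3 ≤ m) {T : Finset (Fin m)} {i : Fin m} (hi : i ∉ T) :
    (mclass (wheel m) (insertNone T) (some i)).card = (rimClass T (rimDegree T i)).card := by
  classical
  rw [← Finset.card_map (s := rimClass T _) Function.Embedding.some]
  congr 1
  ext (_ | j)
  · simp [mem_mclass]
  · simp only [mem_mclass, mem_rimClass, mem_map, Function.Embedding.some_apply,
      Option.some.injEq, exists_eq_right, some_mem_insertNone]
    refine and_congr_right fun hj => ?_
    rw [mrep_eq_iff wheel_connected wheel_dist_le_two (by simpa using hj) (by simpa using hi),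
      card_filter_adj_some hm, card_filter_adj_some hm, Nat.add_right_cancel_iff]

/-- For a set containing the hub, being a `k`-MARS is a condition on the sizes of the
rim classes. -/
lemma isMARS_insertNone_iff (hm : 3 ≤ m) {k : ℕ} (hk : 0 < k) (T : Finset (Fin m)) :
    IsMARS (wheel m) (insertNone T) k ↔
      (∀ a, (rimClass T a).card = 0 ∨ k ≤ (rimClass T a).card) ∧
        ∃ a, (rimClass T a).card = k := by
  constructor
  · rintro ⟨-, -, hall, u, hu, hku⟩
    constructor
    · intro a
      rw [or_iff_not_imp_left, Finset.card_eq_zero]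
      intro hne
      obtain ⟨i, hi⟩ := Finset.nonempty_iff_ne_empty.2 hne
      obtain ⟨hiT, rfl⟩ := mem_rimClass.1 hi
      rw [← card_mclass_insertNone hm hiT]
      exact hall _ (by simpa using hiT)
    · cases u with
      | none => simp at hu
      | some i =>
        exact ⟨_, (card_mclass_insertNone hm (by simpa using hu)).symm.trans hku⟩
  · rintro ⟨hall, a, ha⟩
    obtain ⟨i, hi⟩ : (rimClass T a).Nonempty := Finset.card_pos.1 (by omega)
    obtain ⟨hiT, rfl⟩ := mem_rimClass.1 hi
    refine ⟨⟨none, by simp⟩, ⟨some i, by simpa using hiT⟩, ?_, some i, by simpa using hiT,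
      (card_mclass_insertNone hm hiT).trans ha⟩
    rintro (_ | j) hj
    · simp at hj
    · have hjT : j ∉ T := by simpa using hj
      rw [card_mclass_insertNone hm hjT]
      refine (hall _).resolve_left (Finset.card_ne_zero_of_mem (a := j) ?_)
      exact mem_rimClass.2 ⟨hjT, rfl⟩

/-- Without the hub, the class of the hub has at most three elements. -/
lemma IsMARS.none_mem (hm : 3 ≤ m) {k : ℕ} (hk : 4 ≤ k) {S : Finset (Option (Fin m))}
    (hS : IsMARS (wheel m) S k) : none ∈ S := by
  classical
  by_contra hnone
  obtain ⟨⟨s, hs⟩, -, hall, -⟩ := hS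
  obtain ⟨j, rfl⟩ : ∃ j, s = some j := by
    cases s with
    | none => exact absurd hs hnone
    | some j => exact ⟨j, rfl⟩
  have hhub : S.filter ((wheel m).Adj none) = S := by
    rw [Finset.filter_eq_self]
    rintro (_ | i) hi
    · exact absurd hi hnone
    · exact wheel_adj_none_some i
  have hsub : mclass (wheel m) S none ⊆ {none, some (j + 1), some (j - 1)} := by
    rintro (_ | i) hi
    · simp
    · obtain ⟨hiS, hrep⟩ := mem_mclass.1 hi
      rw [mrep_eq_iff wheel_connected wheel_dist_le_two hiS hnone, hhub] at hrep
      have hadj := Finset.filter_card_eq hrep _ hs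
      simpa using (wheel_adj_some_some hm j i).1 hadj.symm
  have := (hall none hnone).trans ((Finset.card_le_card hsub).trans Finset.card_le_three)
  omega

lemma rimDegree_le_two (T : Finset (Fin m)) (i : Fin m) : rimDegree T i ≤ 2 := by
  unfold rimDegree
  split_ifs <;> simp

lemma sum_rimDegree (T : Finset (Fin m)) : ∑ i, rimDegree T i = 2 * T.card := by
  have h1 : ∑ i, (if i + 1 ∈ T then 1 else 0) = ∑ i, if i ∈ T then 1 else 0 :=
    Equiv.sum_comp (Equiv.addRight (1 : Fin m)) (fun i => if i ∈ T then 1 else 0)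
  have h2 : ∑ i, (if i - 1 ∈ T then 1 else 0) = ∑ i, if i ∈ T then 1 else 0 :=
    Equiv.sum_comp (Equiv.subRight (1 : Fin m)) (fun i => if i ∈ T then 1 else 0)
  simp only [rimDegree, Finset.sum_add_distrib, h1, h2]
  simp [two_mul]

lemma sum_compl_eq (T : Finset (Fin m)) (f : ℕ → ℕ) :
    ∑ i ∈ Tᶜ, f (rimDegree T i) = (rimClass T 0).card * f 0 + (rimClass T 1).card * f 1 +
      (rimClass T 2).card * f 2 := by
  have hmaps : ∀ i ∈ Tᶜ, rimDegree T i ∈ Finset.range 3 := fun i _ =>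
    Finset.mem_range.2 (Nat.lt_succ_of_le (rimDegree_le_two T i))
  have hclass (a : ℕ) : Tᶜ.filter (fun i => rimDegree T i = a) = rimClass T a := by
    ext i
    simp [rimClass]
  have hfib (a : ℕ) : ∑ i ∈ rimClass T a, f (rimDegree T i) = (rimClass T a).card * f a := by
    rw [Finset.sum_const_nat]
    intro i hi
    rw [(mem_rimClass.1 hi).2]
  rw [← Finset.sum_fiberwise_of_maps_to hmaps]
  simp [Finset.sum_range_succ, hclass, hfib]

lemma card_rimClass_add_card (T : Finset (Fin m)) :
    (rimClass T 0).card + (rimClass T 1).card + (rimClass T 2).card + T.card = m := by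
  have h := sum_compl_eq T (fun _ => 1)
  have hc := T.card_compl_add_card
  simp only [Finset.sum_const, smul_eq_mul, mul_one] at h
  rw [Fintype.card_fin] at hc
  omega

lemma card_rimClass_le (T : Finset (Fin m)) :
    (rimClass T 1).card + 2 * (rimClass T 2).card ≤ 2 * T.card := by
  have h := sum_compl_eq T id
  have hle : ∑ i ∈ Tᶜ, id (rimDegree T i) ≤ ∑ i, rimDegree T i :=
    Finset.sum_le_sum_of_subset (Finset.subset_univ _)
  rw [sum_rimDegree, h] at hle
  simp only [id] at hle
  omega

lemma rimClass_eq_empty_of_two_lt (T : Finset (Fin m)) {a : ℕ} (ha : 2 < a) :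
    rimClass T a = ∅ := by
  rw [rimClass, Finset.filter_eq_empty_iff]
  rintro i - ⟨-, rfl⟩
  exact absurd (rimDegree_le_two T i) (by omega)

/-- If no rim vertex has exactly one neighbour in `T`, a vertex with no neighbour in `T`
propagates around the rim. -/
lemma eq_empty_of_rimClass_one_eq_empty {T : Finset (Fin m)} (h1 : rimClass T 1 = ∅)
    (h0 : (rimClass T 0).Nonempty) : T = ∅ := by
  obtain ⟨i, hi⟩ := h0
  have hstep (j : Fin m) (hj : j ∈ rimClass T 0) : j + 1 ∈ rimClass T 0 := by
    obtain ⟨hjT, hdeg⟩ := mem_rimClass.1 hj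
    have hnext : j + 1 ∉ T := fun h => by simp [rimDegree, h] at hdeg
    have hnot : j + 1 ∉ rimClass T 1 := by simp [h1]
    simp only [mem_rimClass, hnext, rimDegree, add_sub_cancel_right, hjT] at hnot ⊢
    split_ifs at hnot ⊢ <;> simp_all
  have hiter (r : ℕ) : i + Fin.ofNat m r ∈ rimClass T 0 := by
    induction r with
    | zero => simpa using hi
    | succ r ih =>
      have := hstep _ ih
      rw [add_assoc] at this
      convert this using 2
      apply Fin.ext
      simp [Fin.val_add]
  refine Finset.eq_empty_of_forall_notMem fun j => ?_
  have hj := hiter (j - i).val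
  rw [Fin.ofNat_val_eq_self, add_sub_cancel] at hj
  exact (mem_rimClass.1 hj).1

/-- The numerical constraints satisfied by the rim classes of a `k`-MARS of the wheel. -/
lemma IsMARS.exists_rim (hm : 3 ≤ m) {k : ℕ} (hk : 4 ≤ k) (hkm : k < m)
    {S : Finset (Option (Fin m))} (hS : IsMARS (wheel m) S k) :
    ∃ t c₀ c₁ c₂ : ℕ, S.card = t + 1 ∧ c₀ + c₁ + c₂ + t = m ∧ c₁ + 2 * c₂ ≤ 2 * t ∧
      (c₁ = 0 → c₀ = 0) ∧ (c₀ = 0 ∨ k ≤ c₀) ∧ (c₁ = 0 ∨ k ≤ c₁) ∧ (c₂ = 0 ∨ k ≤ c₂) ∧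
      (c₀ = k ∨ c₁ = k ∨ c₂ = k) := by
  classical
  obtain ⟨T, rfl⟩ : ∃ T, S = insertNone T := by
    refine ⟨eraseNone S, ?_⟩
    rw [insertNone_eraseNone, Finset.insert_eq_of_mem (hS.none_mem hm hk)]
  obtain ⟨hall, a, ha⟩ := (isMARS_insertNone_iff hm (by omega) T).1 hS
  have hsum := card_rimClass_add_card T
  have hle := card_rimClass_le T
  have haq : (rimClass T 0).card = k ∨ (rimClass T 1).card = k ∨ (rimClass T 2).card = k := by
    rcases Nat.lt_or_ge 2 a with h | h
    · rw [rimClass_eq_empty_of_two_lt T h, Finset.card_empty] at ha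
      omega
    · interval_cases a <;> simp [ha]
  refine ⟨T.card, _, _, _, card_insertNone T, hsum, hle, fun h1 => ?_, hall 0, hall 1, hall 2,
    haq⟩
  by_contra h0
  have hT := eq_empty_of_rimClass_one_eq_empty (Finset.card_eq_zero.1 h1)
    (Finset.card_pos.1 (Nat.pos_of_ne_zero h0))
  have hcard : T.card = 0 := by rw [hT, Finset.card_empty]
  omega

lemma val_add_one_eq_ite (i : Fin m) :
    ((i + 1 : Fin m) : ℕ) = if (i : ℕ) + 1 = m then 0 else (i : ℕ) + 1 := by
  rw [Fin.val_add, Fin.val_one', Nat.add_mod_mod]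
  have := i.isLt
  split_ifs with h
  · rw [h, Nat.mod_self]
  · exact Nat.mod_eq_of_lt (by omega)

lemma val_sub_one_eq_ite (hm : 3 ≤ m) (i : Fin m) :
    ((i - 1 : Fin m) : ℕ) = if (i : ℕ) = 0 then m - 1 else (i : ℕ) - 1 := by
  have h := val_add_one_eq_ite (i - 1)
  rw [sub_add_cancel] at h
  have := i.isLt
  have := (i - 1).isLt
  split_ifs at h ⊢ <;> omega

/-- A `k`-MARS all of whose outside vertices have exactly one rim neighbour inside. -/
lemma exists_isMARS_card_eq_sub (hm : 3 ≤ m) {h : ℕ} (hh : 0 < h) (hhm : 3 * h ≤ m) :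
    ∃ S, IsMARS (wheel m) S (2 * h) ∧ S.card = m + 1 - 2 * h := by
  let T : Finset (Fin m) :=
    Finset.univ.filter (fun i => ¬ ((i : ℕ) < 3 * h ∧ (i : ℕ) % 3 ≠ 0))
  have hdeg (i : Fin m) (hi : i ∉ T) : rimDegree T i = 1 := by
    simp only [T, rimDegree, mem_filter, mem_univ, true_and, val_add_one_eq_ite, val_sub_one_eq_ite hm]
      at hi ⊢
    have := i.isLt
    grind
  have hcompl : Tᶜ.card = 2 * h := by
    rw [← card_filter_lt_mod_three_ne (m := m) (c := 0) (by omega) hhm]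
    congr 1
    ext i
    simp [T]
  have hone : rimClass T 1 = Tᶜ := by
    ext i
    simpa [rimClass] using hdeg i
  have hother (a : ℕ) (ha : a ≠ 1) : rimClass T a = ∅ := by
    rw [rimClass, Finset.filter_eq_empty_iff]
    rintro i - ⟨hi, rfl⟩
    exact ha (hdeg i hi)
  refine ⟨insertNone T, (isMARS_insertNone_iff hm (by omega) T).2 ⟨fun a => ?_, 1, ?_⟩, ?_⟩
  · by_cases ha : a = 1
    · right
      rw [ha, hone, hcompl]
    · left
      rw [hother a ha, Finset.card_empty]
  · rw [hone, hcompl]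
  · have := T.card_compl_add_card
    rw [Fintype.card_fin] at this
    rw [card_insertNone]
    omega

/-- A `k`-MARS with isolated rim vertices spaced three apart, leaving a long gap. -/
lemma exists_isMARS_card_eq_half (hm : 3 ≤ m) {h : ℕ} (hh : 0 < h) (hhm : 5 * h ≤ m) :
    ∃ S, IsMARS (wheel m) S (2 * h) ∧ S.card = h + 1 := by
  let T : Finset (Fin m) :=
    Finset.univ.filter (fun i => (i : ℕ) < 3 * h ∧ (i : ℕ) % 3 = 1)
  have hdeg (i : Fin m) (hi : i ∉ T) : rimDegree T i = if (i : ℕ) < 3 * h then 1 else 0 := by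
    simp only [T, rimDegree, mem_filter, mem_univ, true_and, val_add_one_eq_ite, val_sub_one_eq_ite hm]
      at hi ⊢
    have := i.isLt
    grind
  have hone : (rimClass T 1).card = 2 * h := by
    rw [← card_filter_lt_mod_three_ne (m := m) (c := 1) (by omega) (by omega)]
    congr 1
    ext i
    have := hdeg i
    simp only [mem_rimClass, mem_filter, mem_univ, true_and]
    simp only [T, mem_filter, mem_univ, true_and] at this ⊢
    grind
  have htwo : rimClass T 2 = ∅ := by
    rw [rimClass, Finset.filter_eq_empty_iff]
    rintro i - ⟨hi, h2⟩
    rw [hdeg i hi] at h2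
    grind
  have hcard : T.card = h := by
    have hT : T = Finset.univ.filter (fun i : Fin m => (i : ℕ) < 3 * h) \
        Finset.univ.filter (fun i : Fin m => (i : ℕ) < 3 * h ∧ (i : ℕ) % 3 ≠ 1) := by
      ext i
      simp only [T, mem_filter, mem_univ, true_and, mem_sdiff]
      tauto
    rw [hT, Finset.card_sdiff_of_subset
      (Finset.monotone_filter_right _ fun _ _ hx => hx.1),
      card_filter_lt_mod_three_ne (by omega) (by omega), Fin.card_filter_val_lt]
    omega
  have hsum := card_rimClass_add_card T
  rw [htwo, Finset.card_empty, hone, hcard] at hsum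
  refine ⟨insertNone T, (isMARS_insertNone_iff hm (by omega) T).2 ⟨fun a => ?_, 1, hone⟩,
    by rw [card_insertNone, hcard]⟩
  rcases Nat.lt_or_ge 2 a with ha | ha
  · simp [rimClass_eq_empty_of_two_lt T ha]
  · interval_cases a
    · omega
    · omega
    · simp [htwo]

end Wheel

/-- for the wheel `W_{1,n-1}` on `n ≥ 7` vertices and even `k` with
`4 ≤ k < n - 1`:
(a) if `2n ≥ 5k + 2` then `msad_k(W_{1,n-1}) = (k + 2)/2`;
(b) if `3k + 2 ≤ 2n < 5k + 2` then `msad_k(W_{1,n-1}) = n - k`;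
(c) if `2n < 3k + 2` then `W_{1,n-1}` has no `k`-multiset antiresolving set. -/
theorem stmt16 (n k : ℕ) (hn : 7 ≤ n) (hk4 : 4 ≤ k) (hkn : k < n - 1) (hke : k % 2 = 0) :
    (5 * k + 2 ≤ 2 * n → MsadEq (wheel (n - 1)) k ((k + 2) / 2)) ∧
    (3 * k + 2 ≤ 2 * n → 2 * n < 5 * k + 2 → MsadEq (wheel (n - 1)) k (n - k)) ∧
    (2 * n < 3 * k + 2 →
      ∀ S : Finset (Option (Fin (n - 1))), ¬ IsMARS (wheel (n - 1)) S k) := by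
  obtain ⟨m, rfl⟩ : ∃ m, n = m + 1 := ⟨n - 1, by omega⟩
  obtain ⟨h, rfl⟩ : ∃ h, k = 2 * h := ⟨k / 2, by omega⟩
  rw [Nat.add_sub_cancel] at *
  have : NeZero m := ⟨by omega⟩
  have hm : 3 ≤ m := by omega
  refine ⟨fun hlarge => ⟨?_, fun S hS => ?_⟩, fun hge hlt => ⟨?_, fun S hS => ?_⟩,
    fun hsmall S hS => ?_⟩
  · obtain ⟨S, hS, hcard⟩ := exists_isMARS_card_eq_half hm (h := h) (by omega) (by omega)
    exact ⟨S, hS, by omega⟩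
  · obtain ⟨t, c₀, c₁, c₂, h⟩ := hS.exists_rim hm hk4 hkn
    omega
  · exact exists_isMARS_card_eq_sub hm (by omega) (by omega)
  · obtain ⟨t, c₀, c₁, c₂, h⟩ := hS.exists_rim hm hk4 hkn
    omega
  · obtain ⟨t, c₀, c₁, c₂, h⟩ := hS.exists_rim hm hk4 hkn
    omega
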